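/- Let Γ be a finitely generated group containing a finite normal subgroup F such that the quotient Γ/F is isomorphic to ℤⁿ. Then Γ contains a finite-index subgroup isomorphic to ℤⁿ. -/

import Mathlib

/-- If all commutators lie in a finite normal subgroup `F`, some positive power of every element
lies in the center of the centralizer of `F`. -/
theorem exists_pow_mem_center_centralizer {G : Type*} [Group G] (F : Subgroup G) [F.Normal]
    [Finite F] (hcomm : ∀ x y : G, x⁻¹ * (y * x * y⁻¹) ∈ F) :
    ∃ N : ℕ, N ≠ 0 ∧ ∀ x : G,
      ∃ z : Subgroup.center (Subgroup.centralizer (F : Set G)), ((z : _) : G) = x ^ N := by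
  have : Finite (MulAut F) := Finite.of_injective (fun e : MulAut F => (e : F → F))
    DFunLike.coe_injective
  refine ⟨Nat.card (MulAut F) * Nat.card F, mul_ne_zero Nat.card_pos.ne' Nat.card_pos.ne',
    fun x => ?_⟩
  have hx : x ^ Nat.card (MulAut F) ∈ Subgroup.centralizer (F : Set G) := by
    have h : MulAut.conjNormal (H := F) (x ^ Nat.card (MulAut F)) = 1 := by
      rw [map_pow, pow_card_eq_one']
    rw [Subgroup.mem_centralizer_iff]
    intro f hf
    have h' := congrArg Subtype.val (DFunLike.congr_fun h ⟨f, hf⟩)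
    simp only [MulAut.conjNormal_apply, MulAut.one_apply] at h'
    exact (mul_inv_eq_iff_eq_mul.mp h').symm
  rw [pow_mul]
  generalize x ^ Nat.card (MulAut F) = u at hx
  refine ⟨⟨⟨u, hx⟩ ^ Nat.card F, Subgroup.mem_center_iff.mpr ?_⟩, rfl⟩
  rintro ⟨y, hy⟩
  apply Subtype.ext
  change y * u ^ Nat.card F = u ^ Nat.card F * y
  have hc := hcomm u y
  have hcu : Commute u (u⁻¹ * (y * u * y⁻¹)) :=
    (Subgroup.mem_centralizer_iff.mp hx _ hc).symm
  have hpow : (u⁻¹ * (y * u * y⁻¹)) ^ Nat.card F = 1 :=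
    congrArg Subtype.val (pow_card_eq_one' (x := (⟨_, hc⟩ : F)))
  rw [← mul_inv_eq_iff_eq_mul, ← conj_pow]
  calc (y * u * y⁻¹) ^ Nat.card F = (u * (u⁻¹ * (y * u * y⁻¹))) ^ Nat.card F := by
        rw [mul_inv_cancel_left]
    _ = u ^ Nat.card F := by rw [hcu.mul_pow, hpow, mul_one]

/-- A subgroup whose image under a surjective homomorphism with finite kernel has finite index
has finite index. -/
theorem Subgroup.index_ne_zero_of_map {G A : Type*} [Group G] [Group A] (f : G →* A)
    (hf : Function.Surjective f) [Finite f.ker] (H : Subgroup G) (h : (H.map f).index ≠ 0) :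
    H.index ≠ 0 := by
  rw [Subgroup.index_map, f.range_eq_top_of_surjective hf, Subgroup.index_top, mul_one] at h
  rw [← Subgroup.relIndex_mul_index (le_sup_left : H ≤ H ⊔ f.ker)]
  refine mul_ne_zero ?_ h
  have hsurj : Function.Surjective fun k : f.ker =>
      (QuotientGroup.mk (Subgroup.inclusion le_sup_right k) :
        ↥(H ⊔ f.ker) ⧸ H.subgroupOf (H ⊔ f.ker)) := by
    intro q
    obtain ⟨⟨x, hx⟩, rfl⟩ := QuotientGroup.mk_surjective q
    obtain ⟨k, hk, y, hy, rfl⟩ := Subgroup.mem_sup_of_normal_left.mp (sup_comm H f.ker ▸ hx)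
    refine ⟨⟨k, hk⟩, QuotientGroup.eq.mpr ?_⟩
    simpa [Subgroup.mem_subgroupOf] using hy
  have := Finite.of_surjective _ hsurj
  exact Subgroup.index_ne_zero_of_finite

/-- A homomorphism from a commutative group to `ℤⁿ` hitting all `N`-th powers has a section up to
`N`-th powers. -/
theorem exists_monoidHom_map_eq_pow {Z : Type*} [CommGroup Z] {n : ℕ}
    (q : Z →* Multiplicative (Fin n → ℤ)) (N : ℕ) (h : ∀ v, ∃ z, q z = v ^ N) :
    ∃ φ : Multiplicative (Fin n → ℤ) →* Z, ∀ v, q (φ v) = v ^ N := by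
  choose z hz using h
  let f : (Fin n → ℤ) →ₗ[ℤ] Additive Z := (Pi.basisFun ℤ (Fin n)).constr ℤ fun i =>
    Additive.ofMul (z (Multiplicative.ofAdd (Pi.basisFun ℤ (Fin n) i)))
  have hf : (MonoidHom.toAdditiveLeft q).toIntLinearMap ∘ₗ f = (N : ℤ) • LinearMap.id := by
    refine (Pi.basisFun ℤ (Fin n)).ext fun i => ?_
    rw [LinearMap.comp_apply, Module.Basis.constr_basis]
    change Multiplicative.toAdd (q (z _)) = _
    rw [hz]
    simp
  refine ⟨AddMonoidHom.toMultiplicativeLeft f.toAddMonoidHom, fun v => ?_⟩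
  have h := LinearMap.congr_fun hf v.toAdd
  rw [LinearMap.smul_apply, LinearMap.id_apply, natCast_zsmul] at h
  exact h

/-- If a finitely generated group `Γ` has a finite normal subgroup `F`
with `Γ/F ≅ ℤⁿ`, then `Γ` has a finite-index subgroup isomorphic to `ℤⁿ`. -/
theorem stmt9 {Γ : Type*} [Group Γ] (hfg : Group.FG Γ) {n : ℕ} (F : Subgroup Γ)
    [F.Normal] (hfin : (F : Set Γ).Finite)
    (hiso : Nonempty ((Γ ⧸ F) ≃* Multiplicative (Fin n → ℤ))) :
    ∃ H : Subgroup Γ, H.index ≠ 0 ∧ Nonempty (↥H ≃* Multiplicative (Fin n → ℤ)) := by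
  obtain ⟨e⟩ := hiso
  let p : Γ →* Multiplicative (Fin n → ℤ) := e.toMonoidHom.comp (QuotientGroup.mk' F)
  have hp : Function.Surjective p := e.surjective.comp (QuotientGroup.mk'_surjective F)
  have hker : p.ker = F := by
    ext x
    simp [p]
  have : Finite F := hfin
  have : Finite p.ker := hker ▸ this
  obtain ⟨N, hN, hz⟩ := exists_pow_mem_center_centralizer F fun x y => by
    rw [← hker, MonoidHom.mem_ker]
    simp
  let ι : Subgroup.center (Subgroup.centralizer (F : Set Γ)) →* Γ :=
    (Subgroup.subtype _).comp (Subgroup.subtype _)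
  obtain ⟨ψ, hψ⟩ : ∃ ψ : Multiplicative (Fin n → ℤ) →* _, ∀ v, p (ι (ψ v)) = v ^ N := by
    open scoped IsMulCommutative in
    refine exists_monoidHom_map_eq_pow (p.comp ι) N fun v => ?_
    obtain ⟨g, rfl⟩ := hp v
    obtain ⟨z, hz⟩ := hz g
    exact ⟨z, (congrArg p hz).trans (map_pow p g N)⟩
  have hinj : Function.Injective (ι.comp ψ) := fun v w h => by
    have h' : v ^ N = w ^ N := by rw [← hψ, ← hψ]; exact congrArg p h
    have h'' : N • v.toAdd = N • w.toAdd := h'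
    exact Multiplicative.toAdd.injective (nsmul_right_injective hN h'')
  refine ⟨(ι.comp ψ).range, Subgroup.index_ne_zero_of_map p hp _ ?_,
    ⟨(MonoidHom.ofInjective hinj).symm⟩⟩
  have hrange : p.comp (ι.comp ψ) = powMonoidHom N := MonoidHom.ext hψ
  rw [← MonoidHom.range_comp, hrange]
  exact (Subgroup.finiteIndex_range_powMonoidHom_of_fg _ hN).index_ne_zero
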